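/- arXiv:1912.01663 — 3 statements merged into one kernel-verified Lean document; each statement's English description precedes it below -/
import Mathlib

section
/- Let l_m > 0, β > 0, let φ : ℝ → ℝ be a probability density supported in [0, l_m], and let s ∈ ℂ with Re(s) ≥ 1 and φ*(s) ≠ 0, where φ*(s) = ∫₀^{l_m} φ(z) z^{s−1} dz. Define H_s(λ) = λ^{−s−2} / (β φ*(s)) for λ > 0. Then for every l > 0 the integral β ∫_{l/l_m}^∞ λ φ(l/λ) H_s(λ) dλ converges absolutely and equals l^{−s}. -/
open MeasureTheory Set

/-- The Mellin integral of a function cut off at `a` is an integral over `(0, a]`. -/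
theorem mellin_indicator_Iio (f : ℝ → ℂ) (a : ℝ) (s : ℂ) :
    mellin ((Iio a).indicator f) s = ∫ z in Ioc 0 a, f z * (z : ℂ) ^ (s - 1) := by
  have h : (fun t : ℝ => (t : ℂ) ^ (s - 1) • (Iio a).indicator f t) =
      (Iio a).indicator fun t : ℝ => f t * (t : ℂ) ^ (s - 1) := by
    ext t
    by_cases ht : t ∈ Iio a <;> simp [ht, mul_comm]
  rw [mellin, h, setIntegral_indicator measurableSet_Iio, Ioi_inter_Iio,
    ← integral_Ioc_eq_integral_Ioo]

/-- An integrable function cut off at `a` has a convergent Mellin integral for `1 ≤ re s`. -/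
theorem MellinConvergent.indicator_Iio {f : ℝ → ℂ} (hf : Integrable f) (a : ℝ) {s : ℂ}
    (hs : 1 ≤ s.re) : MellinConvergent ((Iio a).indicator f) s := by
  have h : (fun t : ℝ => (t : ℂ) ^ (s - 1) • (Iio a).indicator f t) =
      (Iio a).indicator fun t : ℝ => (t : ℂ) ^ (s - 1) * f t := by
    ext t
    by_cases ht : t ∈ Iio a <;> simp [ht]
  rw [MellinConvergent, h, IntegrableOn, integrable_indicator_iff measurableSet_Iio, IntegrableOn,
    Measure.restrict_restrict measurableSet_Iio, Iio_inter_Ioi]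
  refine hf.restrict.bdd_mul (c := a ^ (s.re - 1)) ?_ ?_
  · exact (Measurable.pow_const Complex.measurable_ofReal _).aestronglyMeasurable
  · filter_upwards [ae_restrict_mem measurableSet_Ioo] with t ht
    rw [Complex.norm_cpow_eq_rpow_re_of_pos ht.1, Complex.sub_re, Complex.one_re]
    exact Real.rpow_le_rpow ht.1.le ht.2.le (by linarith)

/-- Reflecting and scaling the argument of a Mellin transform. -/
theorem HasMellin.comp_const_mul_inv {f : ℝ → ℂ} {s m : ℂ} (hf : HasMellin f s m) {l : ℝ}
    (hl : 0 < l) : HasMellin (fun t => f (l * t⁻¹)) (-s) ((l : ℂ) ^ (-s) * m) := by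
  constructor
  · have h := MellinConvergent.comp_rpow (f := fun u => f (l * u)) (s := -s) (a := -1) (by simp)
    simp only [Real.rpow_neg_one] at h
    rw [h]
    simpa using (MellinConvergent.comp_mul_left hl).2 hf.1
  · rw [mellin_comp_inv (fun u => f (l * u)), neg_neg, mellin_comp_mul_left f s hl, hf.2,
      smul_eq_mul]

/-- Model solution for the random-line operator: the power function
`H_s(λ) = λ^(−s−2) / (β φ*(s))` solves `L[H](l) = l^(−s)`, the integral
converging absolutely. -/
theorem line_model_solution (lm β : ℝ) (hlm : 0 < lm) (hβ : 0 < β)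
    (φ : ℝ → ℝ)
    (hφ_meas : Measurable φ)
    (hφ_nn : ∀ᵐ x : ℝ, 0 ≤ φ x)
    (hφ_one : (∫ x : ℝ, φ x) = 1)
    (hφ_supp : ∀ᵐ x : ℝ, x ∉ Set.Icc 0 lm → φ x = 0)
    (s : ℂ) (hs : 1 ≤ s.re)
    (Φ : ℂ) (hΦdef : Φ = ∫ z in Set.Ioc 0 lm, (φ z : ℂ) * (z : ℂ) ^ (s - 1))
    (hΦ : Φ ≠ 0)
    (H : ℝ → ℂ) (hH : ∀ lam : ℝ, H lam = (lam : ℂ) ^ (-s - 2) / ((β : ℂ) * Φ))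
    (l : ℝ) (hl : 0 < l) :
    IntegrableOn (fun lam : ℝ => (lam : ℂ) * (φ (l / lam) : ℂ) * H lam)
      (Set.Ioi (l / lm)) ∧
    (β : ℂ) * (∫ lam in Set.Ioi (l / lm),
      (lam : ℂ) * (φ (l / lam) : ℂ) * H lam) = (l : ℂ) ^ (-s) := by
  have hφ_int : Integrable φ := not_imp_comm.1 integral_undef (by simp [hφ_one])
  have hm : HasMellin ((Iio lm).indicator fun x => (φ x : ℂ)) s Φ :=
    ⟨.indicator_Iio hφ_int.ofReal lm hs, by rw [mellin_indicator_Iio, hΦdef]⟩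
  obtain ⟨hconv, hval⟩ := hm.comp_const_mul_inv hl
  have hll : 0 < l / lm := div_pos hl hlm
  have heq : EqOn (fun t : ℝ => (t : ℂ) ^ (-s - 1) •
        (Iio lm).indicator (fun x => (φ x : ℂ)) (l * t⁻¹))
      ((Ioi (l / lm)).indicator fun t => β * Φ * ((t : ℂ) * (φ (l / t) : ℂ) * H t)) (Ioi 0) := by
    intro t (ht : 0 < t)
    have hβ' : (β : ℂ) ≠ 0 := mod_cast hβ.ne'
    have ht' : (t : ℂ) ≠ 0 := mod_cast ht.ne'
    have hiff : l * t⁻¹ ∈ Iio lm ↔ t ∈ Ioi (l / lm) := by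
      rw [mem_Iio, mem_Ioi, ← div_eq_mul_inv, div_lt_comm₀ ht hlm]
    have hpow : (t : ℂ) ^ (-s - 1) = t * (t : ℂ) ^ (-s - 2) := by
      rw [show -s - 1 = 1 + (-s - 2) by ring, Complex.cpow_add _ _ ht', Complex.cpow_one]
    beta_reduce
    by_cases h : t ∈ Ioi (l / lm)
    · rw [indicator_of_mem (hiff.2 h), indicator_of_mem h, hH, hpow, smul_eq_mul,
        ← div_eq_mul_inv]
      field_simp
    · simp only [indicator_of_notMem (mt hiff.1 h), indicator_of_notMem h, smul_zero]
  have hβΦ : (β : ℂ) * Φ ≠ 0 := mul_ne_zero (mod_cast hβ.ne') hΦ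
  have hinter : Ioi (0 : ℝ) ∩ Ioi (l / lm) = Ioi (l / lm) :=
    inter_eq_right.2 (Ioi_subset_Ioi hll.le)
  rw [MellinConvergent, integrableOn_congr_fun heq measurableSet_Ioi, IntegrableOn,
    integrable_indicator_iff measurableSet_Ioi, IntegrableOn,
    Measure.restrict_restrict measurableSet_Ioi, inter_comm, hinter,
    integrable_const_mul_iff hβΦ.isUnit] at hconv
  rw [mellin, setIntegral_congr_fun measurableSet_Ioi heq,
    setIntegral_indicator measurableSet_Ioi, hinter, integral_const_mul] at hval
  exact ⟨hconv, mul_right_cancel₀ hΦ (by rw [← hval]; ring)⟩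
end

section
/- Let σ_m > 0, α > 0, and let h, φ : ℝ → ℝ be probability densities supported in [0, σ_m]. Let μ > 1 be such that φ*(μ + iν) ≠ 0 for every ν ∈ ℝ, and such that both ν ↦ h*(μ + iν) and ν ↦ h*(μ + iν)/φ*(μ + iν) belong to L¹(ℝ). Define, for λ > 0, H(λ) = (2/α) · (λ^{−2μ}/(2π)) ∫_ℝ (h*(μ + iν)/φ*(μ + iν)) λ^{−2iν} dν. Then for almost every σ > 0 the integral α ∫_{√(σ/σ_m)}^∞ φ(σ/λ²) (H(λ)/λ) dλ converges absolutely and equals h(σ) (in particular h(σ) = 0 there for σ > σ_m). -/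
open MeasureTheory Set

/-- The Mellin transform of a function supported in `[0, c]`. -/
noncomputable def mellinT (c : ℝ) (f : ℝ → ℝ) (s : ℂ) : ℂ :=
  ∫ z in Set.Ioc 0 c, (f z : ℂ) * (z : ℂ) ^ (s - 1)

section FourierInversion

open scoped FourierTransform ContDiff

variable {V E : Type*} [NormedAddCommGroup V] [InnerProductSpace ℝ V] [FiniteDimensional ℝ V]
  [MeasurableSpace V] [BorelSpace V] [NormedAddCommGroup E] [NormedSpace ℂ E] [CompleteSpace E]

theorem integral_fourier_smul_eq_integral_smul_fourier {f : V → ℂ} {g : V → E}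
    (hf : Integrable f) (hg : Integrable g) :
    ∫ x, 𝓕 f x • g x = ∫ x, f x • 𝓕 g x := by
  simpa using! VectorFourier.integral_fourierIntegral_smul_eq_flip (L := innerₗ V)
    Real.continuous_fourierChar continuous_inner hf hg

theorem integral_fourierInv_smul_eq_integral_smul_fourierInv {f : V → ℂ} {g : V → E}
    (hf : Integrable f) (hg : Integrable g) :
    ∫ x, 𝓕⁻ f x • g x = ∫ x, f x • 𝓕⁻ g x := by
  have h := integral_fourier_smul_eq_integral_smul_fourier hf hg.comp_neg
  rw [← integral_neg_eq_self] at h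
  simp_rw [Real.fourierInv_eq_fourier_neg f]
  rw [Real.fourierInv_eq_fourier_comp_neg g]
  simpa using h

/-- Fourier inversion for an integrable function with integrable Fourier transform, without any
continuity assumption: it holds almost everywhere. -/
theorem MeasureTheory.Integrable.fourierInv_fourier_ae_eq {f : V → E}
    (hf : Integrable f) (hf' : Integrable (𝓕 f)) : 𝓕⁻ (𝓕 f) =ᵐ[volume] f := by
  have hcont : Continuous (𝓕⁻ (𝓕 f)) :=
    VectorFourier.fourierIntegral_continuous Real.continuous_fourierChar
      (by exact continuous_inner.neg) hf'
  refine ae_eq_of_integral_contDiff_smul_eq hcont.locallyIntegrable hf.locallyIntegrable ?_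
  intro g hg hgc
  let ψ : SchwartzMap V ℂ := HasCompactSupport.toSchwartzMap (f := fun x ↦ (g x : ℂ))
    (hgc.comp_left (g := Complex.ofReal) rfl) (Complex.ofRealCLM.contDiff.comp hg)
  have hψ : 𝓕 (𝓕⁻ (ψ : V → ℂ)) = ψ := by
    rw [← SchwartzMap.fourierInv_coe, ← SchwartzMap.fourier_coe,
      FourierTransform.fourier_fourierInv_eq]
  have h1 := integral_fourierInv_smul_eq_integral_smul_fourierInv ψ.integrable hf'
  have h2 := integral_fourier_smul_eq_integral_smul_fourier (𝓕⁻ ψ).integrable hf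
  rw [SchwartzMap.fourierInv_coe, hψ] at h2
  exact h1.symm.trans h2.symm

end FourierInversion

section Mellin

open Complex
open scoped FourierTransform Real

/-- Almost-everywhere version of `mellinInv_mellin_eq`, for functions that need not be continuous. -/
theorem mellinInv_mellin_ae_eq {E : Type*} [NormedAddCommGroup E] [NormedSpace ℂ E]
    [CompleteSpace E] (σ : ℝ) (f : ℝ → E) (hf : MellinConvergent f σ)
    (hFf : VerticalIntegrable (mellin f) σ) :
    ∀ᵐ x : ℝ, 0 < x → mellinInv σ (mellin f) x = f x := by
  let g := fun (u : ℝ) ↦ Real.exp (-σ * u) • f (Real.exp (-u))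
  have hg : Integrable g := by
    have himage : (fun u : ℝ ↦ Real.exp (-u)) '' univ = Ioi 0 := by
      rw [image_univ, ← Real.range_exp]
      exact neg_surjective.range_comp Real.exp
    rw [MellinConvergent, ← himage, integrableOn_image_iff_integrableOn_abs_deriv_smul
      MeasurableSet.univ (fun x _ ↦ ((hasDerivAt_neg x).exp).hasDerivWithinAt)
      (Real.exp_injective.comp neg_injective).injOn, integrableOn_univ] at hf
    refine hf.congr (ae_of_all _ fun u ↦ ?_)
    have hexp : (Real.exp (-u) : ℂ) ^ ((σ : ℂ) - 1) = (Real.exp (-(u * (σ - 1))) : ℝ) := by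
      rw [← ofReal_one, ← ofReal_sub, ← ofReal_cpow (Real.exp_pos _).le, ← Real.exp_mul, neg_mul]
    simp only [g, hexp, mul_neg, mul_one, abs_neg, Real.abs_exp, coe_smul, smul_smul,
      ← Real.exp_add]
    ring_nf
  have h2π : 2 * π ≠ 0 := by positivity
  have hg' : Integrable (𝓕 g) := by
    have : Integrable (𝓕 (fun u ↦ Real.exp (-(σ * u)) • f (Real.exp (-u)))) := by
      simpa [mellin_eq_fourier, mul_div_cancel_right₀ _ h2π] using hFf.comp_mul_right' h2π
    simp_rw [neg_mul_eq_neg_mul] at this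
    exact this
  have hnull : volume ((fun u : ℝ ↦ Real.exp (-u)) '' {u | 𝓕⁻ (𝓕 g) u ≠ g u}) = 0 :=
    addHaar_image_eq_zero_of_differentiableOn_of_addHaar_eq_zero volume
      (by fun_prop) (hg.fourierInv_fourier_ae_eq hg')
  filter_upwards [compl_mem_ae_iff.mpr hnull] with x hx hx0
  have hinv : 𝓕⁻ (𝓕 g) (-Real.log x) = g (-Real.log x) := by
    by_contra hne
    exact hx ⟨-Real.log x, hne, by simp [Real.exp_log hx0]⟩
  calc
    mellinInv σ (mellin f) x
      = mellinInv σ (fun s ↦ 𝓕 g (s.im / (2 * π))) x := by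
      simp [g, mellinInv, mellin_eq_fourier]
    _ = (x : ℂ) ^ (-σ : ℂ) • g (-Real.log x) := by
      rw [mellinInv_eq_fourierInv _ _ hx0, ← hinv]
      simp [mul_div_cancel_left₀ _ h2π]
    _ = f x := by
      have hpow : Real.exp (-σ * -Real.log x) = x ^ σ := by
        rw [Real.rpow_def_of_pos hx0]; ring_nf
      have hcpow : (x : ℂ) ^ (-σ : ℂ) = (x ^ (-σ) : ℝ) := by
        rw [ofReal_cpow hx0.le, ofReal_neg]
      simp only [g, hpow, hcpow, neg_neg, Real.exp_log hx0, coe_smul, smul_smul]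
      rw [← Real.rpow_add hx0, neg_add_cancel, Real.rpow_zero, one_smul]

theorem mellin_indicator_eq_mellinT (c : ℝ) (f : ℝ → ℝ) (s : ℂ) :
    mellin ((Ioc 0 c).indicator fun x ↦ (f x : ℂ)) s = mellinT c f s := by
  have h : ∀ t : ℝ, (t : ℂ) ^ (s - 1) • (Ioc 0 c).indicator (fun x ↦ (f x : ℂ)) t =
      (Ioc 0 c).indicator (fun x ↦ (f x : ℂ) * (x : ℂ) ^ (s - 1)) t := fun t ↦ by
    by_cases ht : t ∈ Ioc 0 c <;> simp [ht, mul_comm]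
  simp_rw [mellin, mellinT, h]
  rw [setIntegral_indicator measurableSet_Ioc, inter_eq_right.mpr Ioc_subset_Ioi_self]

theorem integrableOn_mul_cpow_Ioc {f : ℝ → ℝ} (hf : Integrable f) (c : ℝ) {s : ℂ}
    (hs : 1 ≤ s.re) : IntegrableOn (fun x : ℝ ↦ (f x : ℂ) * (x : ℂ) ^ (s - 1)) (Ioc 0 c) := by
  refine hf.ofReal.integrableOn.mul_bdd (c := c ^ (s.re - 1))
    (measurable_ofReal.pow_const _).aestronglyMeasurable ?_
  refine (ae_restrict_iff' measurableSet_Ioc).mpr (ae_of_all _ fun x hx ↦ ?_)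
  rw [norm_cpow_eq_rpow_re_of_pos hx.1, sub_re, one_re]
  exact Real.rpow_le_rpow hx.1.le hx.2 (by linarith)

theorem mellinConvergent_indicator {f : ℝ → ℝ} (hf : Integrable f) (c : ℝ) {s : ℂ}
    (hs : 1 ≤ s.re) : MellinConvergent ((Ioc 0 c).indicator fun x ↦ (f x : ℂ)) s := by
  have h := (integrableOn_mul_cpow_Ioc hf c hs).integrable_indicator measurableSet_Ioc
  refine h.integrableOn.congr (ae_of_all _ fun t ↦ ?_)
  by_cases ht : t ∈ Ioc 0 c <;> simp [ht, mul_comm]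

theorem ae_integral_mellinT_mul_cpow {f : ℝ → ℝ} (hf : Integrable f) (c : ℝ) {μ : ℝ} (hμ : 1 ≤ μ)
    (hF : Integrable fun ν : ℝ ↦ mellinT c f (μ + ν * I)) :
    ∀ᵐ x : ℝ, 0 < x → ∫ ν : ℝ, (x : ℂ) ^ (-(μ + ν * I)) * mellinT c f (μ + ν * I) =
      2 * π * (Ioc 0 c).indicator (fun x ↦ (f x : ℂ)) x := by
  have h := mellinInv_mellin_ae_eq μ _ (mellinConvergent_indicator hf c (s := μ) (by simpa))
    (by simpa only [VerticalIntegrable, mellin_indicator_eq_mellinT] using hF)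
  filter_upwards [h] with x hx hx0
  rw [← hx hx0]
  simp only [mellinInv, mellin_indicator_eq_mellinT, real_smul, smul_eq_mul]
  generalize integral (volume : Measure ℝ) (_ : ℝ → ℂ) = J
  push_cast
  field_simp

theorem integrable_prod_cpow_kernel {f : ℝ → ℝ} (hf : Integrable f) (c : ℝ) {μ : ℝ} (hμ : 1 ≤ μ)
    {Q : ℝ → ℂ} (hQ : Integrable Q) {x : ℝ} (hx : 0 < x) :
    Integrable (fun p : ℝ × ℝ ↦ (f p.1 * (p.1 : ℂ) ^ (μ + p.2 * I - 1)) *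
      ((x : ℂ) ^ (-(μ + p.2 * I)) * Q p.2)) ((volume.restrict (Ioc 0 c)).prod volume) := by
  have hpos : ∀ᵐ p ∂((volume.restrict (Ioc 0 c)).prod (volume : Measure ℝ)), p.1 ∈ Ioc 0 c :=
    Measure.quasiMeasurePreserving_fst.ae (ae_restrict_mem measurableSet_Ioc)
  have h := ((integrableOn_mul_cpow_Ioc hf c (s := μ) (by simpa)).mul_prod hQ).bdd_mul
    (c := x ^ (-μ)) (f := fun p : ℝ × ℝ ↦ (p.1 : ℂ) ^ (p.2 * I) * (x : ℂ) ^ (-(μ + p.2 * I)))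
    (by fun_prop) ?_
  · refine h.congr ?_
    filter_upwards [hpos] with p hp
    have hadd : (p.1 : ℂ) ^ (μ + p.2 * I - 1) =
        (p.1 : ℂ) ^ ((μ : ℂ) - 1) * (p.1 : ℂ) ^ (p.2 * I) := by
      rw [← cpow_add _ _ (ofReal_ne_zero.mpr hp.1.ne')]; ring_nf
    rw [hadd]; ring
  · filter_upwards [hpos] with p hp
    rw [norm_mul, norm_cpow_eq_rpow_re_of_pos hp.1, norm_cpow_eq_rpow_re_of_pos hx]
    simp

/-- Integrating an inverse Mellin kernel against `f` multiplies the symbol `Q` by the Mellin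
transform of `f`. -/
theorem integral_integral_cpow_kernel {f : ℝ → ℝ} (hf : Integrable f) (c : ℝ) {μ : ℝ}
    (hμ : 1 ≤ μ) {Q : ℝ → ℂ} (hQ : Integrable Q) {x : ℝ} (hx : 0 < x) :
    ∫ z in Ioc 0 c, ∫ ν : ℝ, (f z * (z : ℂ) ^ (μ + ν * I - 1)) * ((x : ℂ) ^ (-(μ + ν * I)) * Q ν) =
      ∫ ν : ℝ, (x : ℂ) ^ (-(μ + ν * I)) * (mellinT c f (μ + ν * I) * Q ν) := by
  rw [integral_integral_swap (integrable_prod_cpow_kernel hf c hμ hQ hx)]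
  refine integral_congr_ae (ae_of_all _ fun ν ↦ ?_)
  simp only [integral_mul_const, mellinT]
  ring

theorem div_sq_cpow_mul_cpow {x t : ℝ} (hx : 0 < x) (ht : 0 < t) (s : ℂ) :
    ((x / t ^ 2 : ℝ) : ℂ) ^ (s - 1) * (x : ℂ) ^ (-s) = t ^ 2 / x * (t : ℂ) ^ (-(2 * s)) := by
  have hx' : (x : ℂ) ≠ 0 := ofReal_ne_zero.mpr hx.ne'
  have ht' : (t : ℂ) ≠ 0 := ofReal_ne_zero.mpr ht.ne'
  have hz : ((x / t ^ 2 : ℝ) : ℂ) ≠ 0 := ofReal_ne_zero.mpr (by positivity)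
  rw [cpow_sub _ _ hz, cpow_one, cpow_def_of_ne_zero hz, cpow_def_of_ne_zero hx',
    cpow_def_of_ne_zero ht', ← ofReal_log (by positivity), ← ofReal_log hx.le, ← ofReal_log ht.le,
    Real.log_div hx.ne' (by positivity), Real.log_pow, div_mul_eq_mul_div, ← exp_add]
  push_cast
  rw [div_eq_mul_inv, inv_div, mul_comm]
  ring_nf

theorem image_div_sq_Ioi {x c : ℝ} (hx : 0 < x) (hc : 0 < c) :
    (fun t : ℝ ↦ x / t ^ 2) '' Ioi √(x / c) = Ioo 0 c := by
  ext z
  constructor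
  · rintro ⟨t, ht, rfl⟩
    have ht0 : 0 < t := (Real.sqrt_nonneg _).trans_lt ht
    refine ⟨by positivity, ?_⟩
    have := (Real.sqrt_lt' ht0).mp ht
    rw [div_lt_iff₀ hc] at this
    simp only
    rw [div_lt_iff₀ (by positivity)]
    linarith
  · rintro ⟨hz, hzc⟩
    refine ⟨√(x / z), Real.sqrt_lt_sqrt (by positivity) (by gcongr), ?_⟩
    simp only
    rw [Real.sq_sqrt (by positivity)]
    field_simp

theorem hasDerivAt_div_sq (x : ℝ) {t : ℝ} (ht : 0 < t) :
    HasDerivAt (fun t : ℝ ↦ x / t ^ 2) (-(2 * x / t ^ 3)) t := by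
  have := (hasDerivAt_const t x).div (hasDerivAt_pow 2 t) (by positivity)
  refine this.congr_deriv ?_
  simp
  field_simp

theorem injOn_div_sq {x : ℝ} (hx : 0 < x) : InjOn (fun t : ℝ ↦ x / t ^ 2) (Ioi 0) := by
  intro a ha b hb hab
  have ha' : 0 < a := ha
  have hb' : 0 < b := hb
  simp only at hab
  rw [div_eq_div_iff (by positivity) (by positivity), mul_right_inj' hx.ne'] at hab
  exact (pow_left_inj₀ ha'.le hb'.le two_ne_zero).mp hab.symm

end Mellin

/-- Existence part of the Proposition (Random planes): the inverse-Mellin formula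
`H(λ) = (2/α) (λ^(−2μ)/(2π)) ∫ (h*/φ*)(μ+iν) λ^(−2iν) dν` solves the
random-plane equation `α ∫_{√(σ/σ_m)}^∞ φ(σ/λ²) (H(λ)/λ) dλ = h(σ)` for a.e. `σ > 0`. -/
theorem plane_existence (σm α : ℝ) (hσm : 0 < σm) (hα : 0 < α)
    (h φ : ℝ → ℝ)
    (hh_meas : Measurable h)
    (hh_nn : ∀ᵐ x : ℝ, 0 ≤ h x)
    (hh_one : (∫ x : ℝ, h x) = 1)
    (hh_supp : ∀ᵐ x : ℝ, x ∉ Set.Icc 0 σm → h x = 0)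
    (hφ_meas : Measurable φ)
    (hφ_nn : ∀ᵐ x : ℝ, 0 ≤ φ x)
    (hφ_one : (∫ x : ℝ, φ x) = 1)
    (hφ_supp : ∀ᵐ x : ℝ, x ∉ Set.Icc 0 σm → φ x = 0)
    (μ : ℝ) (hμ : 1 < μ)
    (hφne : ∀ ν : ℝ, mellinT σm φ ((μ : ℂ) + ν * Complex.I) ≠ 0)
    (hL1h : Integrable (fun ν : ℝ => mellinT σm h ((μ : ℂ) + ν * Complex.I)))
    (hL1q : Integrable (fun ν : ℝ =>
      mellinT σm h ((μ : ℂ) + ν * Complex.I) / mellinT σm φ ((μ : ℂ) + ν * Complex.I)))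
    (H : ℝ → ℂ)
    (hH : ∀ lam : ℝ, 0 < lam → H lam =
      ((2 / α * (lam ^ (-(2 * μ)) / (2 * Real.pi)) : ℝ) : ℂ) *
        ∫ ν : ℝ, (mellinT σm h ((μ : ℂ) + ν * Complex.I) /
            mellinT σm φ ((μ : ℂ) + ν * Complex.I)) *
          (lam : ℂ) ^ (-(2 * (ν : ℂ)) * Complex.I)) :
    ∀ᵐ σ : ℝ, 0 < σ →
      (IntegrableOn (fun lam : ℝ => (φ (σ / lam ^ 2) : ℂ) * (H lam / (lam : ℂ)))
          (Set.Ioi (Real.sqrt (σ / σm))) ∧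
        (α : ℂ) * (∫ lam in Set.Ioi (Real.sqrt (σ / σm)),
          (φ (σ / lam ^ 2) : ℂ) * (H lam / (lam : ℂ))) = (h σ : ℂ)) := by
  have hφ : Integrable φ := by
    by_contra hn
    simp [integral_undef hn] at hφ_one
  have hh : Integrable h := by
    by_contra hn
    simp [integral_undef hn] at hh_one
  filter_upwards [ae_integral_mellinT_mul_cpow hh σm hμ.le hL1h, hh_supp] with σ hinv hsupp hσ
  set Q : ℝ → ℂ := fun ν ↦ mellinT σm h (μ + ν * Complex.I) / mellinT σm φ (μ + ν * Complex.I)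
  let G : ℝ → ℂ := fun z ↦ ∫ ν : ℝ, (φ z * (z : ℂ) ^ (μ + ν * Complex.I - 1)) *
    ((σ : ℂ) ^ (-(μ + ν * Complex.I)) * Q ν)
  have hGint : IntegrableOn G (Ioo 0 σm) :=
    IntegrableOn.mono_set (integrable_prod_cpow_kernel hφ σm hμ.le hL1q hσ).integral_prod_left
      Ioo_subset_Ioc_self
  have hG : ∫ z in Ioo 0 σm, G z = 2 * Real.pi * h σ := by
    rw [← integral_Ioc_eq_integral_Ioo, integral_integral_cpow_kernel hφ σm hμ.le hL1q hσ]
    have hQ : ∀ ν : ℝ, mellinT σm φ (μ + ν * Complex.I) * Q ν =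
        mellinT σm h (μ + ν * Complex.I) := fun ν ↦ mul_div_cancel₀ _ (hφne ν)
    simp_rw [hQ, hinv hσ]
    by_cases hc : σ ≤ σm
    · simp [hσ, hc]
    · simp [hc, hsupp fun hmem ↦ hc hmem.2]
  have hpos : ∀ t ∈ Ioi √(σ / σm), 0 < t := fun t ht ↦ (Real.sqrt_nonneg _).trans_lt ht
  have hderiv : ∀ t ∈ Ioi √(σ / σm), HasDerivWithinAt (fun t : ℝ ↦ σ / t ^ 2)
      (-(2 * σ / t ^ 3)) (Ioi √(σ / σm)) t :=
    fun t ht ↦ (hasDerivAt_div_sq σ (hpos t ht)).hasDerivWithinAt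
  have hinj : InjOn (fun t : ℝ ↦ σ / t ^ 2) (Ioi √(σ / σm)) := (injOn_div_sq hσ).mono hpos
  have hintegrand : ∀ t ∈ Ioi √(σ / σm), (φ (σ / t ^ 2) : ℂ) * (H t / t) =
      (2 * Real.pi * α : ℂ)⁻¹ * (|-(2 * σ / t ^ 3)| • G (σ / t ^ 2)) := by
    intro t ht
    have ht0 := hpos t ht
    have ht' : (t : ℂ) ≠ 0 := Complex.ofReal_ne_zero.mpr ht0.ne'
    have hσ' : (σ : ℂ) ≠ 0 := Complex.ofReal_ne_zero.mpr hσ.ne'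
    have hα' : (α : ℂ) ≠ 0 := Complex.ofReal_ne_zero.mpr hα.ne'
    have hGt : G (σ / t ^ 2) = φ (σ / t ^ 2) * (t ^ 2 / σ) * (t ^ (-(2 * μ)) : ℝ) *
        ∫ ν : ℝ, Q ν * (t : ℂ) ^ (-(2 * (ν : ℂ)) * Complex.I) := by
      rw [← integral_const_mul]
      refine integral_congr_ae (ae_of_all _ fun ν ↦ ?_)
      have hk := div_sq_cpow_mul_cpow hσ ht0 (μ + ν * Complex.I)
      have hsplit : (t : ℂ) ^ (-(2 * (μ + ν * Complex.I))) =
          (t ^ (-(2 * μ)) : ℝ) * (t : ℂ) ^ (-(2 * (ν : ℂ)) * Complex.I) := by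
        rw [Complex.ofReal_cpow ht0.le, ← Complex.cpow_add _ _ ht']
        push_cast
        ring_nf
      rw [hsplit] at hk
      linear_combination (φ (σ / t ^ 2) : ℂ) * Q ν * hk
    have hHt : H t = ((2 / α * (t ^ (-(2 * μ)) / (2 * Real.pi)) : ℝ) : ℂ) *
        ∫ ν : ℝ, Q ν * (t : ℂ) ^ (-(2 * (ν : ℂ)) * Complex.I) := hH t ht0
    rw [hGt, hHt, abs_neg, abs_of_pos (by positivity), Complex.real_smul]
    generalize integral (volume : Measure ℝ) (_ : ℝ → ℂ) = J
    push_cast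
    field_simp
  have hon : IntegrableOn (fun t : ℝ ↦ |-(2 * σ / t ^ 3)| • G (σ / t ^ 2)) (Ioi √(σ / σm)) := by
    rwa [← integrableOn_image_iff_integrableOn_abs_deriv_smul measurableSet_Ioi hderiv hinj,
      image_div_sq_Ioi hσ hσm]
  refine ⟨IntegrableOn.congr_fun (hon.const_mul _) (fun t ht ↦ (hintegrand t ht).symm)
    measurableSet_Ioi, ?_⟩
  rw [setIntegral_congr_fun measurableSet_Ioi hintegrand, integral_const_mul,
    ← integral_image_eq_integral_abs_deriv_smul measurableSet_Ioi hderiv hinj,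
    image_div_sq_Ioi hσ hσm, hG]
  have hα' : (α : ℂ) ≠ 0 := Complex.ofReal_ne_zero.mpr hα.ne'
  have hπ : (Real.pi : ℂ) ≠ 0 := Complex.ofReal_ne_zero.mpr Real.pi_ne_zero
  field_simp
end

section
/- Let σ_m > 0, α > 0, and let h, φ : ℝ → ℝ be probability densities supported in [0, σ_m], with φ*(μ + iν) ≠ 0 for every ν ∈ ℝ for some μ > 1. Suppose H₁, H₂ : (0, ∞) → ℂ are measurable functions with ∫₀^∞ λ^{2μ − 1} |H_j(λ)| dλ < ∞ for j = 1, 2, and that for almost every σ > 0 both integrals α ∫_{√(σ/σ_m)}^∞ φ(σ/λ²) (H_j(λ)/λ) dλ converge absolutely and equal h(σ) (where h(σ) = 0 for σ > σ_m). Then H₁ = H₂ almost everywhere on (0, ∞). -/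
open MeasureTheory Set

open Complex in
open scoped FourierTransform SchwartzMap ContDiff in
/-- The Fourier transform is injective on integrable functions. -/
theorem ae_eq_zero_of_fourier_eq_zero {f : ℝ → ℂ} (hf : Integrable f)
    (h : ∀ ξ, 𝓕 f ξ = 0) : ∀ᵐ x, f x = 0 := by
  refine ae_eq_zero_of_integral_contDiff_smul_eq_zero hf.locallyIntegrable
    fun g g_smooth g_cpt ↦ ?_
  have hg₁ : HasCompactSupport (ofRealCLM ∘ g) := g_cpt.comp_left rfl
  have hg₂ : ContDiff ℝ ∞ (ofRealCLM ∘ g) := by fun_prop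
  let G : 𝓢(ℝ, ℂ) := hg₁.toSchwartzMap hg₂
  have key := VectorFourier.integral_fourierIntegral_smul_eq_flip (L := innerₗ ℝ) (μ := volume)
    (ν := volume) (f := f) (g := ⇑(𝓕⁻ G : 𝓢(ℝ, ℂ))) Real.continuous_fourierChar continuous_inner hf
    (𝓕⁻ G : 𝓢(ℝ, ℂ)).integrable
  rw [flip_innerₗ] at key
  change ∫ ξ, 𝓕 f ξ • (𝓕⁻ G : 𝓢(ℝ, ℂ)) ξ = ∫ x, f x • 𝓕 (⇑(𝓕⁻ G : 𝓢(ℝ, ℂ))) x at key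
  rw [← SchwartzMap.fourier_coe, FourierTransform.fourier_fourierInv_eq] at key
  simp only [h, zero_smul, integral_zero] at key
  rw [key]
  congr 1 with x
  have hG : G x = g x := rfl
  rw [hG, real_smul, smul_eq_mul, mul_comm]

/-- A function whose Mellin transform converges absolutely on a vertical line and vanishes there
is zero almost everywhere on `(0, ∞)`. -/
theorem ae_eq_zero_of_mellin_eq_zero {f : ℝ → ℂ} {c : ℝ} (hf : MellinConvergent f c)
    (h : ∀ t : ℝ, mellin f (c + t * Complex.I) = 0) : ∀ᵐ x : ℝ, 0 < x → f x = 0 := by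
  have himage : (fun u : ℝ ↦ Real.exp (-u)) '' univ = Ioi 0 := by
    rw [image_univ, ← Real.range_exp]
    exact neg_surjective.range_comp Real.exp
  have hderiv : ∀ u ∈ univ, HasDerivWithinAt (fun u : ℝ ↦ Real.exp (-u)) (-Real.exp (-u)) univ u :=
    fun u _ ↦ by simpa using (hasDerivAt_neg u).exp
  have hinj : InjOn (fun u : ℝ ↦ Real.exp (-u)) univ :=
    (Real.exp_injective.comp neg_injective).injOn
  let g : ℝ → ℂ := fun u ↦ Real.exp (-c * u) • f (Real.exp (-u))
  have hg : Integrable g := by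
    rw [MellinConvergent, ← himage, integrableOn_image_iff_integrableOn_abs_deriv_smul
      MeasurableSet.univ hderiv hinj, integrableOn_univ] at hf
    refine hf.congr (.of_forall fun u ↦ ?_)
    have hpow : ((Real.exp (-u) : ℝ) : ℂ) ^ ((c : ℂ) - 1)
        = ((Real.exp (-u * (c - 1)) : ℝ) : ℂ) := by
      rw [Real.exp_mul, Complex.ofReal_cpow (Real.exp_pos _).le]
      simp
    simp only [g, hpow, abs_neg, Real.abs_exp, smul_eq_mul, Complex.real_smul]
    rw [← mul_assoc, ← Complex.ofReal_mul, ← Real.exp_add]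
    ring_nf
  have hzero : ∀ᵐ u, g u = 0 := by
    refine ae_eq_zero_of_fourier_eq_zero hg fun ξ ↦ ?_
    have := h (ξ * (2 * Real.pi))
    rw [mellin_eq_fourier] at this
    simpa [g, Real.pi_ne_zero] using this
  have hnull := addHaar_image_eq_zero_of_differentiableOn_of_addHaar_eq_zero volume
    (f := fun u : ℝ ↦ Real.exp (-u)) (by fun_prop) (ae_iff.1 hzero)
  refine measure_mono_null (fun x hx ↦ ?_) hnull
  replace hx : 0 < x ∧ f x ≠ 0 := by simpa using hx
  refine ⟨-Real.log x, ?_, by simp [Real.exp_log hx.1]⟩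
  simp [g, Real.exp_log hx.1, hx.2]

open Complex in
/-- The Mellin transform of the quadratic multiplicative convolution of `ψ` and `H`. -/
theorem mellin_integral_comp_div_sq {ψ H : ℝ → ℂ} (hψm : Measurable ψ) (hHm : Measurable H)
    {s : ℂ} (hψ : MellinConvergent ψ s) (hH : MellinConvergent H (2 * s)) :
    mellin (fun σ ↦ ∫ x in Ioi 0, ψ (σ / x ^ 2) * (H x / x)) s
      = mellin ψ s * mellin H (2 * s) := by
  have hfactor : ∀ x : ℝ, 0 < x →
      (((x ^ 2)⁻¹ : ℝ) : ℂ) ^ (-s) * (H x / x) = (x : ℂ) ^ (2 * s - 1) * H x := by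
    intro x hx
    have hx0 : (x : ℂ) ≠ 0 := ofReal_ne_zero.mpr hx.ne'
    have h1 : (((x ^ 2)⁻¹ : ℝ) : ℂ) ^ (-s) = (x : ℂ) ^ (2 * s) := by
      have harg : ((x ^ 2 : ℝ) : ℂ).arg ≠ Real.pi := by
        rw [arg_ofReal_of_nonneg (by positivity)]
        exact Real.pi_pos.ne
      rw [ofReal_inv, inv_cpow _ _ harg, cpow_neg, inv_inv, pow_two, ofReal_mul,
        mul_cpow_ofReal_nonneg hx.le hx.le, ← cpow_add _ _ hx0, two_mul]
    rw [h1, cpow_sub _ _ hx0, cpow_one]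
    ring
  have hslice : ∀ x : ℝ, 0 < x →
      mellin (fun σ ↦ ψ (σ / x ^ 2)) s = (((x ^ 2)⁻¹ : ℝ) : ℂ) ^ (-s) * mellin ψ s := by
    intro x hx
    simpa only [div_eq_inv_mul, smul_eq_mul] using
      mellin_comp_mul_left ψ s (a := (x ^ 2)⁻¹) (by positivity)
  have hslice_conv : ∀ x : ℝ, 0 < x → MellinConvergent (fun σ ↦ ψ (σ / x ^ 2)) s := by
    intro x hx
    simpa only [div_eq_inv_mul] using
      (MellinConvergent.comp_mul_left (f := ψ) (s := s) (a := (x ^ 2)⁻¹) (by positivity)).2 hψ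
  let g : ℝ → ℝ := fun u ↦ ‖(u : ℂ) ^ (s - 1) * ψ u‖
  have hslice_norm : ∀ x : ℝ, 0 < x →
      ∫ σ in Ioi (0 : ℝ), ‖(σ : ℂ) ^ (s - 1) * (ψ (σ / x ^ 2) * (H x / x))‖
        = (∫ u in Ioi 0, g u) * ‖(x : ℂ) ^ (2 * s - 1) * H x‖ := by
    intro x hx
    set a : ℝ := (x ^ 2)⁻¹ with ha_def
    have ha : 0 < a := by positivity
    have ha0 : (a : ℂ) ≠ 0 := ofReal_ne_zero.mpr ha.ne'
    have hcomp := integral_comp_mul_left_Ioi g 0 ha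
    rw [mul_zero] at hcomp
    have heq : EqOn (fun σ : ℝ ↦ ‖(σ : ℂ) ^ (s - 1) * (ψ (σ / x ^ 2) * (H x / x))‖)
        (fun σ ↦ g (a * σ) * ‖(a : ℂ) ^ (1 - s) * (H x / x)‖) (Ioi 0) := by
      intro σ hσ
      simp only [g, ← norm_mul]
      congr 1
      rw [ofReal_mul, mul_cpow_ofReal_nonneg ha.le (le_of_lt hσ), div_eq_inv_mul, ← ha_def,
        show (1 - s) = -(s - 1) by ring, cpow_neg]
      have : (a : ℂ) ^ (s - 1) ≠ 0 := by simp [cpow_eq_zero_iff, ha0]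
      field_simp
    rw [setIntegral_congr_fun measurableSet_Ioi heq, integral_mul_const, hcomp, ← hfactor x hx,
      ← ha_def, sub_eq_add_neg, cpow_add _ _ ha0, cpow_one]
    simp only [norm_mul, norm_real, Real.norm_eq_abs, abs_of_pos ha, smul_eq_mul]
    field_simp
  let F : ℝ × ℝ → ℂ := fun p ↦ (p.2 : ℂ) ^ (s - 1) * (ψ (p.2 / p.1 ^ 2) * (H p.1 / p.1))
  have hFm : Measurable F := by
    fun_prop
  have hF : Integrable F ((volume.restrict (Ioi 0)).prod (volume.restrict (Ioi 0))) := by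
    rw [integrable_prod_iff hFm.aestronglyMeasurable]
    constructor
    · filter_upwards [ae_restrict_mem measurableSet_Ioi] with x hx
      have := (hslice_conv x hx).mul_const (H x / x)
      simpa only [F, smul_eq_mul, mul_assoc] using this
    · have hH' : IntegrableOn (fun x : ℝ ↦ (∫ u in Ioi 0, g u) * ‖(x : ℂ) ^ (2 * s - 1) * H x‖)
          (Ioi 0) := hH.norm.const_mul _
      exact hH'.congr_fun (fun x hx ↦ (hslice_norm x hx).symm) measurableSet_Ioi
  calc mellin (fun σ ↦ ∫ x in Ioi 0, ψ (σ / x ^ 2) * (H x / x)) s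
      = ∫ σ in Ioi 0, ∫ x in Ioi 0, F (x, σ) := by
        simp only [mellin, F, smul_eq_mul, integral_const_mul]
    _ = ∫ x in Ioi 0, ∫ σ in Ioi 0, F (x, σ) :=
        (integral_integral_swap (f := fun x σ ↦ F (x, σ)) hF).symm
    _ = ∫ x in Ioi (0 : ℝ), mellin ψ s * ((x : ℂ) ^ (2 * s - 1) * H x) := by
        refine setIntegral_congr_fun measurableSet_Ioi fun x hx ↦ ?_
        rw [← hfactor x hx, ← mul_assoc, mul_comm (mellin ψ s), ← hslice x hx, mellin]
        simp only [F, ← mul_assoc, integral_mul_const, smul_eq_mul]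
    _ = mellin ψ s * mellin H (2 * s) := by
        rw [integral_const_mul]
        simp only [mellin, smul_eq_mul]

/-- Uniqueness part of the Proposition (Random planes): two solutions of the
random-plane equation with `∫₀^∞ λ^(2μ−1) |H_j(λ)| dλ < ∞` agree a.e. on `(0,∞)`. -/
theorem plane_uniqueness (σm α : ℝ) (hσm : 0 < σm) (hα : 0 < α)
    (h φ : ℝ → ℝ)
    (hh_meas : Measurable h)
    (hh_nn : ∀ᵐ x : ℝ, 0 ≤ h x)
    (hh_one : (∫ x : ℝ, h x) = 1)
    (hh_supp : ∀ᵐ x : ℝ, x ∉ Set.Icc 0 σm → h x = 0)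
    (hφ_meas : Measurable φ)
    (hφ_nn : ∀ᵐ x : ℝ, 0 ≤ φ x)
    (hφ_one : (∫ x : ℝ, φ x) = 1)
    (hφ_supp : ∀ᵐ x : ℝ, x ∉ Set.Icc 0 σm → φ x = 0)
    (μ : ℝ) (hμ : 1 < μ)
    (hφne : ∀ ν : ℝ, mellinT σm φ ((μ : ℂ) + ν * Complex.I) ≠ 0)
    (H₁ H₂ : ℝ → ℂ) (hm1 : Measurable H₁) (hm2 : Measurable H₂)
    (hi1 : IntegrableOn (fun lam : ℝ => lam ^ (2 * μ - 1) * ‖H₁ lam‖) (Set.Ioi 0))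
    (hi2 : IntegrableOn (fun lam : ℝ => lam ^ (2 * μ - 1) * ‖H₂ lam‖) (Set.Ioi 0))
    (heq1 : ∀ᵐ σ : ℝ, 0 < σ →
      (IntegrableOn (fun lam : ℝ => (φ (σ / lam ^ 2) : ℂ) * (H₁ lam / (lam : ℂ)))
          (Set.Ioi (Real.sqrt (σ / σm))) ∧
        (α : ℂ) * (∫ lam in Set.Ioi (Real.sqrt (σ / σm)),
          (φ (σ / lam ^ 2) : ℂ) * (H₁ lam / (lam : ℂ))) = (h σ : ℂ)))
    (heq2 : ∀ᵐ σ : ℝ, 0 < σ →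
      (IntegrableOn (fun lam : ℝ => (φ (σ / lam ^ 2) : ℂ) * (H₂ lam / (lam : ℂ)))
          (Set.Ioi (Real.sqrt (σ / σm))) ∧
        (α : ℂ) * (∫ lam in Set.Ioi (Real.sqrt (σ / σm)),
          (φ (σ / lam ^ 2) : ℂ) * (H₂ lam / (lam : ℂ))) = (h σ : ℂ))) :
    ∀ᵐ lam : ℝ, 0 < lam → H₁ lam = H₂ lam := by
  have hφ_int : Integrable φ := by
    by_contra hφ
    simp [integral_undef hφ] at hφ_one
  let ψ : ℝ → ℂ := (Iio σm).indicator fun z ↦ (φ z : ℂ)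
  let H : ℝ → ℂ := fun x ↦ H₁ x - H₂ x
  have hψm : Measurable ψ :=
    (by fun_prop : Measurable fun z ↦ (φ z : ℂ)).indicator measurableSet_Iio
  have hHm : Measurable H := hm1.sub hm2
  have hIoo : Iio σm ∩ Ioi 0 = Ioo 0 σm := by ext; simp [and_comm]
  have hψ_smul (s : ℂ) : (fun z : ℝ ↦ (z : ℂ) ^ (s - 1) • ψ z)
      = (Iio σm).indicator fun z ↦ (φ z : ℂ) * (z : ℂ) ^ (s - 1) := by
    ext z
    by_cases hz : z ∈ Iio σm <;> simp [ψ, hz, mul_comm]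
  have hψ_mellin (s : ℂ) : mellin ψ s = mellinT σm φ s := by
    rw [mellin, hψ_smul, integral_indicator measurableSet_Iio,
      Measure.restrict_restrict measurableSet_Iio, hIoo, mellinT,
      integral_Ioc_eq_integral_Ioo]
  have hψ_conv (ν : ℝ) : MellinConvergent ψ (μ + ν * Complex.I) := by
    rw [MellinConvergent, hψ_smul, IntegrableOn, integrable_indicator_iff measurableSet_Iio,
      IntegrableOn, Measure.restrict_restrict measurableSet_Iio, hIoo]
    refine Integrable.mul_bdd (c := σm ^ (μ - 1)) hφ_int.ofReal.integrableOn
      (by fun_prop : Measurable fun z : ℝ ↦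
        (z : ℂ) ^ ((μ : ℂ) + ν * Complex.I - 1)).aestronglyMeasurable ?_
    filter_upwards [ae_restrict_mem measurableSet_Ioo] with z hz
    rw [Complex.norm_cpow_eq_rpow_re_of_pos hz.1]
    simpa using Real.rpow_le_rpow hz.1.le hz.2.le (by linarith : 0 ≤ μ - 1)
  have hconv_of {K : ℝ → ℂ} (hK : Measurable K)
      (hKi : IntegrableOn (fun x : ℝ ↦ x ^ (2 * μ - 1) * ‖K x‖) (Ioi 0)) {s : ℂ}
      (hs : s.re = 2 * μ) : MellinConvergent K s := by
    refine (integrable_norm_iff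
      (by fun_prop : Measurable fun x : ℝ ↦ (x : ℂ) ^ (s - 1) • K x).aestronglyMeasurable).1 ?_
    refine hKi.congr_fun (fun x hx ↦ ?_) measurableSet_Ioi
    simp [Complex.norm_cpow_eq_rpow_re_of_pos hx, hs]
  have hH_conv {s : ℂ} (hs : s.re = 2 * μ) : MellinConvergent H s :=
    (hasMellin_sub (hconv_of hm1 hi1 hs) (hconv_of hm2 hi2 hs)).1
  have hconvolution : ∀ᵐ σ : ℝ, 0 < σ → ∫ x in Ioi 0, ψ (σ / x ^ 2) * (H x / x) = 0 := by
    filter_upwards [heq1, heq2] with σ h1 h2 hσ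
    obtain ⟨hint1, heq1⟩ := h1 hσ
    obtain ⟨hint2, heq2⟩ := h2 hσ
    have hind : EqOn (fun x : ℝ ↦ ψ (σ / x ^ 2) * (H x / x))
        ((Ioi (Real.sqrt (σ / σm))).indicator fun x : ℝ ↦
          (φ (σ / x ^ 2) : ℂ) * (H₁ x / x) - (φ (σ / x ^ 2) : ℂ) * (H₂ x / x)) (Ioi 0) := by
      intro x hx
      have hx : 0 < x := hx
      have hiff : σ / x ^ 2 < σm ↔ Real.sqrt (σ / σm) < x := by
        rw [Real.sqrt_lt' hx, div_lt_iff₀ (by positivity), div_lt_iff₀ hσm, mul_comm]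
      by_cases hlt : Real.sqrt (σ / σm) < x
      · simp only [ψ, H, indicator, mem_Iio, mem_Ioi, hiff, hlt, if_true]
        ring
      · simp [ψ, indicator, hiff, hlt]
    rw [setIntegral_congr_fun measurableSet_Ioi hind, setIntegral_indicator measurableSet_Ioi,
      inter_eq_right.2 (Ioi_subset_Ioi (Real.sqrt_nonneg _)), integral_sub hint1 hint2, sub_eq_zero]
    exact mul_left_cancel₀ (Complex.ofReal_ne_zero.2 hα.ne') (heq1.trans heq2.symm)
  have hmellin (ν : ℝ) : mellin H (2 * (μ + ν * Complex.I)) = 0 := by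
    have hprod := mellin_integral_comp_div_sq hψm hHm (hψ_conv ν)
      (hH_conv (s := 2 * (μ + ν * Complex.I)) (by simp))
    rw [hψ_mellin] at hprod
    refine (mul_eq_zero.1 (hprod.symm.trans ?_)).resolve_left (hφne ν)
    refine integral_eq_zero_of_ae ?_
    filter_upwards [ae_restrict_mem measurableSet_Ioi, ae_restrict_of_ae hconvolution]
      with σ hσ hzero
    simp [hzero hσ]
  have hHzero := ae_eq_zero_of_mellin_eq_zero (f := H) (c := 2 * μ) (hH_conv (by simp)) fun t ↦ by
    convert hmellin (t / 2) using 2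
    push_cast
    ring
  filter_upwards [hHzero] with x hx hpos
  exact sub_eq_zero.1 (hx hpos)
end
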